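/- arXiv:1605.05865 — 2 statements merged into one kernel-verified Lean document; each statement's English description precedes it below -/
import Mathlib

section
/- Let y, U, H, P : ℝ × ℝ → ℝ be sufficiently smooth (say C^∞) functions of (ξ,t), and for z ∈ ℂ \ {0} define the 2×2 matrix-valued functions N = y_ξ [[0,0],[1/(4z) − U, 0]] − z[[−U_ξ, −y_ξ],[H_ξ, U_ξ]] and M = (1/(2z))[[0,0],[U − 1/(4z), 0]] − [[0, 1/2],[U² − P, 0]]. Then the zero-curvature (compatibility) condition N_t − M_ξ + [N, M] = 0 holds identically for all z ∈ ℂ \ {0} if and only if the following system holds: y_{ξt} = U_ξ, U_{ξt} = ½ H_ξ + (U² − P) y_ξ, H_{ξt} = 2(U² − P) U_ξ, and U_t y_ξ = −P_ξ. -/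
open MeasureTheory Filter Set Topology

noncomputable section
/-- Partial derivative with respect to the first variable. -/
def pd1 (f : ℝ → ℝ → ℝ) (a b : ℝ) : ℝ := deriv (fun a' => f a' b) a

/-- Partial derivative with respect to the second variable. -/
def pd2 (f : ℝ → ℝ → ℝ) (a b : ℝ) : ℝ := deriv (fun b' => f a b') b
/-- `N = y_ξ [[0,0],[1/(4z) − U, 0]] − z [[−U_ξ, −y_ξ],[H_ξ, U_ξ]]`. -/
def lagN (y U H : ℝ → ℝ → ℝ) (z : ℂ) (ξ t : ℝ) : Matrix (Fin 2) (Fin 2) ℂ :=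
  (pd1 y ξ t : ℂ) • !![0, 0; 1/(4*z) - (U ξ t : ℂ), 0]
    - z • !![-(pd1 U ξ t : ℂ), -(pd1 y ξ t : ℂ); (pd1 H ξ t : ℂ), (pd1 U ξ t : ℂ)]

/-- `M = (1/(2z))[[0,0],[U − 1/(4z), 0]] − [[0, 1/2],[U² − P, 0]]`. -/
def lagM (U P : ℝ → ℝ → ℝ) (z : ℂ) (ξ t : ℝ) : Matrix (Fin 2) (Fin 2) ℂ :=
  (1/(2*z)) • !![0, 0; (U ξ t : ℂ) - 1/(4*z), 0]
    - !![0, (1/2 : ℂ); (U ξ t : ℂ)^2 - (P ξ t : ℂ), 0]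

theorem contDiff_pd1 {f : ℝ → ℝ → ℝ} (hf : ContDiff ℝ (⊤ : ℕ∞) (Function.uncurry f)) :
    ContDiff ℝ (⊤ : ℕ∞) (Function.uncurry (pd1 f)) := by
  have h : Function.uncurry (pd1 f) =
      fun p : ℝ × ℝ => fderiv ℝ (Function.uncurry f) p ((1 : ℝ), (0 : ℝ)) := by
    funext ⟨a, b⟩
    have hd := (hf.differentiable (by simp) (a, b)).hasFDerivAt
    exact (hd.comp_hasDerivAt a ((hasDerivAt_id a).prodMk (hasDerivAt_const a b))).deriv
  rw [h]
  exact (hf.fderiv_right (by simp)).clm_apply contDiff_const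

theorem hasDerivAt_ofReal_pd1 {f : ℝ → ℝ → ℝ}
    (hf : ContDiff ℝ (⊤ : ℕ∞) (Function.uncurry f)) (a b : ℝ) :
    HasDerivAt (fun a' => (f a' b : ℂ)) (pd1 f a b : ℂ) a := by
  have h : Differentiable ℝ fun a' => f a' b :=
    (hf.differentiable (by simp)).comp (differentiable_id.prodMk (differentiable_const b))
  exact (h a).hasDerivAt.ofReal_comp

theorem hasDerivAt_ofReal_pd2 {f : ℝ → ℝ → ℝ}
    (hf : ContDiff ℝ (⊤ : ℕ∞) (Function.uncurry f)) (a b : ℝ) :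
    HasDerivAt (fun b' => (f a b' : ℂ)) (pd2 f a b : ℂ) b := by
  have h : Differentiable ℝ fun b' => f a b' :=
    (hf.differentiable (by simp)).comp ((differentiable_const a).prodMk differentiable_id)
  exact (h b).hasDerivAt.ofReal_comp

theorem lagN_eq (y U H : ℝ → ℝ → ℝ) (z : ℂ) (ξ t : ℝ) :
    lagN y U H z ξ t = !![z * pd1 U ξ t, z * pd1 y ξ t;
      pd1 y ξ t * (1 / (4 * z) - U ξ t) - z * pd1 H ξ t, -(z * pd1 U ξ t)] := by
  ext i j
  fin_cases i <;> fin_cases j <;> simp [lagN]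

theorem lagM_eq (U P : ℝ → ℝ → ℝ) (z : ℂ) (ξ t : ℝ) :
    lagM U P z ξ t = !![0, -(1 / 2);
      1 / (2 * z) * (U ξ t - 1 / (4 * z)) - ((U ξ t : ℂ) ^ 2 - P ξ t), 0] := by
  ext i j
  fin_cases i <;> fin_cases j <;> simp [lagM]

/-- The entries of `N_t - M_ξ + [N, M]`, expanded in powers of `z`. -/
theorem zeroCurvature_eq {y U H P : ℝ → ℝ → ℝ}
    (hy : ContDiff ℝ (⊤ : ℕ∞) (Function.uncurry y)) (hU : ContDiff ℝ (⊤ : ℕ∞) (Function.uncurry U))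
    (hH : ContDiff ℝ (⊤ : ℕ∞) (Function.uncurry H)) (hP : ContDiff ℝ (⊤ : ℕ∞) (Function.uncurry P))
    {z : ℂ} (hz : z ≠ 0) (ξ t : ℝ) (i j : Fin 2) :
    deriv (fun τ => lagN y U H z ξ τ i j) t - deriv (fun χ => lagM U P z χ t i j) ξ
        + (lagN y U H z ξ t * lagM U P z ξ t - lagM U P z ξ t * lagN y U H z ξ t) i j =
      !![z * (pd2 (pd1 U) ξ t - (1 / 2 * pd1 H ξ t + ((U ξ t : ℂ) ^ 2 - P ξ t) * pd1 y ξ t)),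
        z * (pd2 (pd1 y) ξ t - pd1 U ξ t);
        (1 / (4 * z) - U ξ t) * (pd2 (pd1 y) ξ t - pd1 U ξ t)
          - (pd2 U ξ t * pd1 y ξ t + pd1 P ξ t)
          - z * (pd2 (pd1 H) ξ t - 2 * ((U ξ t : ℂ) ^ 2 - P ξ t) * pd1 U ξ t),
        -(z * (pd2 (pd1 U) ξ t
          - (1 / 2 * pd1 H ξ t + ((U ξ t : ℂ) ^ 2 - P ξ t) * pd1 y ξ t)))] i j := by
  have hyt := hasDerivAt_ofReal_pd2 (contDiff_pd1 hy) ξ t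
  have hUt := hasDerivAt_ofReal_pd2 (contDiff_pd1 hU) ξ t
  have hHt := hasDerivAt_ofReal_pd2 (contDiff_pd1 hH) ξ t
  have hU2 := hasDerivAt_ofReal_pd2 hU ξ t
  have hU1 := hasDerivAt_ofReal_pd1 hU ξ t
  have hP1 := hasDerivAt_ofReal_pd1 hP ξ t
  have hN := ((hyt.mul (hU2.const_sub (1 / (4 * z)))).sub (hHt.const_mul z)).deriv
  have hM := (((hU1.sub_const (1 / (4 * z))).const_mul (1 / (2 * z))).sub
    ((hU1.pow 2).sub hP1)).deriv
  simp only [Pi.mul_def, Pi.sub_def, Pi.pow_def] at hN hM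
  simp only [lagN_eq, lagM_eq]
  fin_cases i <;> fin_cases j <;>
    simp only [Fin.zero_eta, Fin.mk_one, Fin.isValue, Matrix.of_apply, Matrix.cons_val',
      Matrix.cons_val_zero, Matrix.cons_val_one, Matrix.cons_val_fin_one, Matrix.sub_apply,
      Matrix.mul_apply, Fin.sum_univ_two, deriv_const]
  · rw [(hUt.const_mul z).deriv]
    field_simp
    ring
  · rw [(hyt.const_mul z).deriv]
    ring
  · rw [hN, hM]
    field_simp
    ring
  · rw [(hUt.const_mul z).fun_neg.deriv]
    field_simp
    ring

/-- the zero-curvature condition `N_t − M_ξ + [N,M] = 0` for all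
`z ≠ 0` is equivalent to the Lagrangian system (4.11). -/
theorem stmt_15 (y U H P : ℝ → ℝ → ℝ)
    (hy : ContDiff ℝ (⊤ : ℕ∞) (Function.uncurry y)) (hU : ContDiff ℝ (⊤ : ℕ∞) (Function.uncurry U))
    (hH : ContDiff ℝ (⊤ : ℕ∞) (Function.uncurry H)) (hP : ContDiff ℝ (⊤ : ℕ∞) (Function.uncurry P)) :
    (∀ z : ℂ, z ≠ 0 → ∀ ξ t : ℝ, ∀ i j : Fin 2,
      deriv (fun τ => lagN y U H z ξ τ i j) t - deriv (fun χ => lagM U P z χ t i j) ξ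
        + (lagN y U H z ξ t * lagM U P z ξ t - lagM U P z ξ t * lagN y U H z ξ t) i j = 0)
    ↔ ∀ ξ t : ℝ,
        pd2 (pd1 y) ξ t = pd1 U ξ t ∧
        pd2 (pd1 U) ξ t = (1/2) * pd1 H ξ t + (U ξ t ^ 2 - P ξ t) * pd1 y ξ t ∧
        pd2 (pd1 H) ξ t = 2 * (U ξ t ^ 2 - P ξ t) * pd1 U ξ t ∧
        pd2 U ξ t * pd1 y ξ t = -(pd1 P ξ t) := by
  constructor
  · intro h ξ t
    have entry {z : ℂ} (hz : z ≠ 0) (i j : Fin 2) :=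
      (zeroCurvature_eq hy hU hH hP hz ξ t i j).symm.trans (h z hz ξ t i j)
    have h00 := entry one_ne_zero 0 0
    have h01 := entry one_ne_zero 0 1
    have h10 := entry one_ne_zero 1 0
    have h10' := entry (neg_ne_zero.mpr one_ne_zero) 1 0
    simp only [Fin.isValue, Matrix.of_apply, Matrix.cons_val', Matrix.cons_val_zero,
      Matrix.cons_val_one, Matrix.cons_val_fin_one, one_mul] at h00 h01 h10 h10'
    rw [h01] at h10 h10'
    norm_cast at h01
    refine ⟨sub_eq_zero.mp h01, ?_, ?_, ?_⟩
    · apply Complex.ofReal_injective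
      push_cast
      linear_combination h00
    · apply Complex.ofReal_injective
      push_cast
      linear_combination (h10' - h10) / 2
    · apply Complex.ofReal_injective
      push_cast
      linear_combination -(h10 + h10') / 2
  · intro h z hz ξ t i j
    obtain ⟨h1, h2, h3, h4⟩ := h ξ t
    rw [zeroCurvature_eq hy hU hH hP hz, h1, h2, h3]
    have h4' : (pd2 U ξ t * pd1 y ξ t : ℂ) = -pd1 P ξ t := by exact_mod_cast h4
    fin_cases i <;> fin_cases j <;> simp [h4']
end
end

section
/- Let y, U, H, P : ℝ × ℝ → ℝ be sufficiently smooth (say C^∞) functions of (ξ,t) satisfying U_{ξt} = ½ H_ξ + (U² − P) y_ξ and U_t y_ξ = −P_ξ. Then P satisfies the second-order differential equation y_ξ P_{ξξ} − y_{ξξ} P_ξ − y_ξ³ P = −½ y_ξ² (2U² y_ξ + H_ξ). -/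
open MeasureTheory Filter Set Topology

noncomputable section
theorem hasDerivAt_pd1 {f : ℝ → ℝ → ℝ} (hf : Differentiable ℝ (Function.uncurry f)) (a b : ℝ) :
    HasDerivAt (fun a' => f a' b) (pd1 f a b) a := by
  have h : DifferentiableAt ℝ (fun a' => Function.uncurry f (a', b)) a := by fun_prop
  exact h.hasDerivAt

theorem pd1_eq_fderiv {f : ℝ → ℝ → ℝ} (hf : Differentiable ℝ (Function.uncurry f)) (a b : ℝ) :
    pd1 f a b = fderiv ℝ (Function.uncurry f) (a, b) (1, 0) :=
  ((hf (a, b)).hasFDerivAt.comp_hasDerivAt (f := fun a' => (a', b)) a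
    ((hasDerivAt_id a).prodMk (hasDerivAt_const a b))).deriv

theorem pd2_eq_fderiv {f : ℝ → ℝ → ℝ} (hf : Differentiable ℝ (Function.uncurry f)) (a b : ℝ) :
    pd2 f a b = fderiv ℝ (Function.uncurry f) (a, b) (0, 1) :=
  ((hf (a, b)).hasFDerivAt.comp_hasDerivAt (f := fun b' => (a, b')) b
    ((hasDerivAt_const b a).prodMk (hasDerivAt_id b))).deriv

theorem uncurry_pd1 {f : ℝ → ℝ → ℝ} (hf : Differentiable ℝ (Function.uncurry f)) :
    Function.uncurry (pd1 f) = fun p => fderiv ℝ (Function.uncurry f) p (1, 0) :=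
  funext fun p => pd1_eq_fderiv hf p.1 p.2

theorem uncurry_pd2 {f : ℝ → ℝ → ℝ} (hf : Differentiable ℝ (Function.uncurry f)) :
    Function.uncurry (pd2 f) = fun p => fderiv ℝ (Function.uncurry f) p (0, 1) :=
  funext fun p => pd2_eq_fderiv hf p.1 p.2

theorem differentiable_fderiv_of_contDiff_two {E F : Type*} [NormedAddCommGroup E]
    [NormedSpace ℝ E] [NormedAddCommGroup F] [NormedSpace ℝ F] {g : E → F}
    (hg : ContDiff ℝ 2 g) : Differentiable ℝ (fderiv ℝ g) :=
  (hg.fderiv_right (m := 1) (by norm_num)).differentiable one_ne_zero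

theorem differentiable_pd1 {f : ℝ → ℝ → ℝ} (hf : ContDiff ℝ 2 (Function.uncurry f)) :
    Differentiable ℝ (Function.uncurry (pd1 f)) := by
  rw [uncurry_pd1 (hf.differentiable two_ne_zero)]
  exact (differentiable_fderiv_of_contDiff_two hf).clm_apply (differentiable_const _)

theorem differentiable_pd2 {f : ℝ → ℝ → ℝ} (hf : ContDiff ℝ 2 (Function.uncurry f)) :
    Differentiable ℝ (Function.uncurry (pd2 f)) := by
  rw [uncurry_pd2 (hf.differentiable two_ne_zero)]
  exact (differentiable_fderiv_of_contDiff_two hf).clm_apply (differentiable_const _)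

/-- Mixed second partial derivatives of a `C^2` function commute. -/
theorem pd1_pd2_comm {f : ℝ → ℝ → ℝ} (hf : ContDiff ℝ 2 (Function.uncurry f)) (a b : ℝ) :
    pd1 (pd2 f) a b = pd2 (pd1 f) a b := by
  have hd := hf.differentiable two_ne_zero
  have hd' := differentiable_fderiv_of_contDiff_two hf (a, b)
  rw [pd1_eq_fderiv (differentiable_pd2 hf), pd2_eq_fderiv (differentiable_pd1 hf),
    uncurry_pd1 hd, uncurry_pd2 hd,
    fderiv_clm_apply hd' (differentiableAt_const _), fderiv_clm_apply hd' (differentiableAt_const _)]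
  have hs := (hf.contDiffAt (x := (a, b))).isSymmSndFDerivAt (by simp)
  simpa using hs.eq (1, 0) (0, 1)

/-- the function `P` satisfies the second-order differential
equation `y_ξ P_ξξ − y_ξξ P_ξ − y_ξ³ P = −½ y_ξ² (2U² y_ξ + H_ξ)`. -/
theorem stmt_16 (y U H P : ℝ → ℝ → ℝ)
    (hy : ContDiff ℝ (⊤ : ℕ∞) (Function.uncurry y)) (hU : ContDiff ℝ (⊤ : ℕ∞) (Function.uncurry U))
    (hH : ContDiff ℝ (⊤ : ℕ∞) (Function.uncurry H)) (hP : ContDiff ℝ (⊤ : ℕ∞) (Function.uncurry P))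
    (h1 : ∀ ξ t : ℝ, pd2 (pd1 U) ξ t = (1/2) * pd1 H ξ t + (U ξ t ^ 2 - P ξ t) * pd1 y ξ t)
    (h2 : ∀ ξ t : ℝ, pd2 U ξ t * pd1 y ξ t = -(pd1 P ξ t)) :
    ∀ ξ t : ℝ,
      pd1 y ξ t * pd1 (pd1 P) ξ t - pd1 (pd1 y) ξ t * pd1 P ξ t
          - (pd1 y ξ t)^3 * P ξ t
        = -(1/2) * (pd1 y ξ t)^2 * (2 * U ξ t ^ 2 * pd1 y ξ t + pd1 H ξ t) := by
  intro ξ t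
  have h2le : (2 : WithTop ℕ∞) ≤ ((⊤ : ℕ∞) : WithTop ℕ∞) := by
    exact WithTop.coe_le_coe.2 le_top
  have hUt := hasDerivAt_pd1 (differentiable_pd2 (hU.of_le h2le)) ξ t
  have hyξ := hasDerivAt_pd1 (differentiable_pd1 (hy.of_le h2le)) ξ t
  have hPξ := (hasDerivAt_pd1 (differentiable_pd1 (hP.of_le h2le)) ξ t).fun_neg
  have key := (hUt.fun_mul hyξ).unique
    (hPξ.congr_of_eventuallyEq (Eventually.of_forall fun ξ' => h2 ξ' t))
  rw [pd1_pd2_comm (hU.of_le h2le), h1] at key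
  linear_combination pd1 y ξ t * key - pd1 (pd1 y) ξ t * h2 ξ t
end
end
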